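/- arXiv:2007.07222 — 4 statements merged into one kernel-verified Lean document; each statement's English description precedes it below -/
import Mathlib

section
/- Let X be a measurable space, Y a label space, and L : Y × Y → ℝ a nonnegative loss that is symmetric (L(y, y') = L(y', y)) and obeys the triangle inequality (L(y1, y3) ≤ L(y1, y2) + L(y2, y3)). Let S and T be probability measures on X, let H be a set of measurable functions X → Y, and let h, h*_S, h*_T ∈ H, with all relevant expected losses finite. Then L_T(h, h*_T) ≤ L_S(h, h*_S) + L_S(h*_S, h*_T) + disc_L(S, T). Consequently, if l_T : X → Y is the target labeling function and L_T(h, l_T) ≤ L_T(h*_T, l_T) + L_T(h, h*_T) (the expected-loss triangle inequality), then L_T(h, l_T) − L_T(h*_T, l_T) ≤ L_S(h, h*_S) + L_S(h*_S, h*_T) + disc_L(S, T). -/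
open MeasureTheory

/-- Expected loss `L_μ(h, h') = ∫ L(h(x), h'(x)) dμ(x)`. -/
noncomputable def expLoss {X Y : Type*} [MeasurableSpace X] (μ : Measure X)
    (L : Y → Y → ℝ) (h h' : X → Y) : ℝ :=
  ∫ x, L (h x) (h' x) ∂μ

/-- Discrepancy distance `disc_L(S,T) = sup_{h1,h2 ∈ H} |L_S(h1,h2) - L_T(h1,h2)|`. -/
noncomputable def discrepancy {X Y : Type*} [MeasurableSpace X] (L : Y → Y → ℝ)
    (H : Set (X → Y)) (S T : Measure X) : ℝ :=
  sSup {r | ∃ h1 ∈ H, ∃ h2 ∈ H, r = |expLoss S L h1 h2 - expLoss T L h1 h2|}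

/-- for a nonnegative, symmetric loss obeying the triangle inequality,
`L_T(h, h*_T) ≤ L_S(h, h*_S) + L_S(h*_S, h*_T) + disc_L(S,T)`; consequently, if the
expected-loss triangle inequality `L_T(h,l_T) ≤ L_T(h*_T,l_T) + L_T(h,h*_T)` holds,
then `L_T(h,l_T) - L_T(h*_T,l_T) ≤ L_S(h,h*_S) + L_S(h*_S,h*_T) + disc_L(S,T)`. -/
theorem target_loss_bound_via_discrepancy {X Y : Type*} [MeasurableSpace X] [MeasurableSpace Y]
    (L : Y → Y → ℝ) (hL_nonneg : ∀ y y', 0 ≤ L y y')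
    (hL_symm : ∀ y y', L y y' = L y' y)
    (hL_tri : ∀ y1 y2 y3, L y1 y3 ≤ L y1 y2 + L y2 y3)
    (S T : Measure X) [IsProbabilityMeasure S] [IsProbabilityMeasure T]
    (H : Set (X → Y)) (hH_meas : ∀ h ∈ H, Measurable h)
    (h hS hT : X → Y) (hh_mem : h ∈ H) (hhS_mem : hS ∈ H) (hhT_mem : hT ∈ H)
    (lT : X → Y)
    (hint_S_h_hS : Integrable (fun x => L (h x) (hS x)) S)
    (hint_S_hS_hT : Integrable (fun x => L (hS x) (hT x)) S)
    (hint_S_h_hT : Integrable (fun x => L (h x) (hT x)) S)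
    (hint_T_h_hT : Integrable (fun x => L (h x) (hT x)) T)
    (hbdd : BddAbove {r | ∃ h1 ∈ H, ∃ h2 ∈ H,
      r = |expLoss S L h1 h2 - expLoss T L h1 h2|}) :
    expLoss T L h hT ≤
      expLoss S L h hS + expLoss S L hS hT + discrepancy L H S T ∧
    (expLoss T L h lT ≤ expLoss T L hT lT + expLoss T L h hT →
      expLoss T L h lT - expLoss T L hT lT ≤
        expLoss S L h hS + expLoss S L hS hT + discrepancy L H S T) := by
  have h1 : |expLoss S L h hT - expLoss T L h hT| ≤ discrepancy L H S T :=
    le_csSup hbdd ⟨h, hh_mem, hT, hhT_mem, rfl⟩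
  have h2 : expLoss S L h hT ≤ expLoss S L h hS + expLoss S L hS hT := by
    unfold expLoss
    rw [← integral_add hint_S_h_hS hint_S_hS_hT]
    exact integral_mono hint_S_h_hT (hint_S_h_hS.add hint_S_hS_hT)
      (fun x => hL_tri _ _ _)
  have h3 := (abs_le.mp h1).1
  exact ⟨by linarith, fun h4 => by linarith⟩
end

section
/- Let X be a measurable space, μ a probability measure on X, M > 0, and F a countable class of measurable functions f : X → [0, M]. Let x_1, …, x_m be drawn i.i.d. from μ. Then for every δ ∈ (0, 1), with probability at least 1 − δ over the draw of the sample, every f ∈ F satisfies E_μ[f] ≤ (1/m) Σ_{i=1}^m f(x_i) + 2·R̂_x(F) + 3M·√(log(2/δ)/(2m)), where R̂_x(F) is the empirical Rademacher complexity of F on the sample x_1, …, x_m. -/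
open MeasureTheory

/-- Empirical Rademacher complexity of a class `F` of real-valued functions on the
sample `x : Fin m → X`: the average over the `2^m` sign vectors of
`sup_{f ∈ F} (1/m) ∑ i σ i * f (x i)`. -/
noncomputable def rademacher {X : Type*} (m : ℕ) (x : Fin m → X)
    (F : Set (X → ℝ)) : ℝ :=
  (∑ σ : Fin m → Bool,
    sSup ((fun f => (m : ℝ)⁻¹ * ∑ i, (if σ i then (1 : ℝ) else -1) * f (x i)) '' F))
    / 2 ^ m

set_option linter.unusedSectionVars false
set_option linter.unusedVariables false

namespace RadAux

lemma integrable_bdd {Ω : Type*} [MeasurableSpace Ω] {P : Measure Ω} [IsFiniteMeasure P]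
    {g : Ω → ℝ} (hg : Measurable g) {B : ℝ} (hB : ∀ x, |g x| ≤ B) : Integrable g P :=
  Integrable.of_bound hg.aestronglyMeasurable B (Filter.Eventually.of_forall hB)

lemma abs_integral_bdd {Ω : Type*} [MeasurableSpace Ω] {P : Measure Ω} [IsProbabilityMeasure P]
    {g : Ω → ℝ} {B : ℝ} (hB : ∀ x, |g x| ≤ B) : |∫ x, g x ∂P| ≤ B := by
  have h := norm_integral_le_of_norm_le_const (μ := P) (f := g) (C := B)
    (Filter.Eventually.of_forall hB)
  simpa using h

lemma integrable_exp_bdd {Ω : Type*} [MeasurableSpace Ω] {P : Measure Ω} [IsFiniteMeasure P]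
    {g : Ω → ℝ} (hg : Measurable g) {B : ℝ} (hB : ∀ x, |g x| ≤ B) :
    Integrable (fun x => Real.exp (g x)) P := by
  refine integrable_bdd (B := Real.exp B) (by fun_prop) fun x => ?_
  rw [abs_of_pos (Real.exp_pos _)]
  exact Real.exp_le_exp.2 (le_of_abs_le (hB x))

/-- Hoeffding's lemma in oscillation form. -/
lemma hoeffding_osc {X : Type*} [MeasurableSpace X] (μ : Measure X) [IsProbabilityMeasure μ]
    {g : X → ℝ} (hg : Measurable g) {c : ℝ} (hc : ∀ a b, |g a - g b| ≤ c) :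
    ∫ a, Real.exp (g a) ∂μ ≤ Real.exp (∫ a, g a ∂μ + c ^ 2 / 8) := by
  obtain ⟨x0⟩ : Nonempty X := nonempty_of_isProbabilityMeasure μ
  have hc0 : 0 ≤ c := (abs_nonneg _).trans (hc x0 x0)
  have hbd : BddBelow (Set.range g) := by
    refine ⟨g x0 - c, ?_⟩
    rintro _ ⟨a, rfl⟩
    have := le_of_abs_le (hc x0 a)
    linarith
  have : Nonempty X := ⟨x0⟩
  have hmem : ∀ a, g a ∈ Set.Icc (⨅ b, g b) ((⨅ b, g b) + c) := by
    intro a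
    refine ⟨ciInf_le hbd a, ?_⟩
    have : g a - c ≤ ⨅ b, g b := le_ciInf fun b => by
      have := le_of_abs_le (hc a b)
      linarith
    linarith
  have h := (ProbabilityTheory.hasSubgaussianMGF_of_mem_Icc (μ := μ) hg.aemeasurable
    (Filter.Eventually.of_forall hmem)).mgf_le 1
  simp only [ProbabilityTheory.mgf, one_mul] at h
  simp_rw [Real.exp_sub] at h
  rw [integral_div, div_le_iff₀ (Real.exp_pos _), ← Real.exp_add] at h
  refine h.trans (Real.exp_le_exp.2 ?_)
  have : ((‖(⨅ b, g b) + c - ⨅ b, g b‖₊ : NNReal) : ℝ) = c := by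
    simp [abs_of_nonneg hc0]
  push_cast at *
  simp only [add_sub_cancel_left, Real.norm_eq_abs, abs_of_nonneg hc0]
  apply le_of_eq; ring

lemma measurable_cons {X : Type*} [MeasurableSpace X] (n : ℕ) :
    Measurable (fun p : X × (Fin n → X) => (Fin.cons p.1 p.2 : Fin (n + 1) → X)) := by
  refine measurable_pi_iff.2 fun i => ?_
  refine Fin.cases ?_ (fun k => ?_) i
  · simpa using measurable_fst
  · simp only [Fin.cons_succ]
    fun_prop

lemma integral_succ {X : Type*} [MeasurableSpace X] (μ : Measure X) [IsProbabilityMeasure μ]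
    (n : ℕ) {g : (Fin (n + 1) → X) → ℝ} (hg : Measurable g)
    (hi : Integrable g (Measure.pi fun _ => μ)) :
    ∫ x, g x ∂(Measure.pi fun _ : Fin (n + 1) => μ) =
      ∫ y, ∫ a, g (Fin.cons a y) ∂μ ∂(Measure.pi fun _ : Fin n => μ) := by
  have hp := (measurePreserving_piFinSuccAbove (fun _ : Fin (n + 1) => μ) 0).symm
  have he : ∀ p : X × (Fin n → X),
      (MeasurableEquiv.piFinSuccAbove (fun _ : Fin (n + 1) => X) 0).symm p
        = Fin.cons p.1 p.2 := by
    intro p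
    simp [MeasurableEquiv.piFinSuccAbove]
    rfl
  have h1 := hp.integral_comp' g
  have h2 := (hp.integrable_comp hg.aestronglyMeasurable).2 hi
  rw [← h1, integral_prod_symm]
  · simp only [he]
  · exact h2

/-- Exponential moment form of McDiarmid's inequality. -/
lemma mcdiarmid {X : Type*} [MeasurableSpace X] (μ : Measure X) [IsProbabilityMeasure μ]
    (c B : ℝ) : ∀ (n : ℕ) (g : (Fin n → X) → ℝ), Measurable g → (∀ x, |g x| ≤ B) →
    (∀ x i a, |g (Function.update x i a) - g x| ≤ c) →
    ∫ x, Real.exp (g x) ∂(Measure.pi fun _ : Fin n => μ) ≤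
      Real.exp (∫ x, g x ∂(Measure.pi fun _ : Fin n => μ) + n * (c ^ 2 / 8)) := by
  intro n
  induction n with
  | zero =>
    intro g _ _ _
    have h : g = fun _ => g Fin.elim0 := funext fun x => by
      rw [Subsingleton.elim x Fin.elim0]
    rw [h]
    simp
  | succ n ih =>
    intro g hg hB hc
    have hgc : Measurable (fun p : X × (Fin n → X) => g (Fin.cons p.1 p.2)) :=
      hg.comp (measurable_cons n)
    have hgy : ∀ y, Measurable (fun a : X => g (Fin.cons a y)) := fun y =>
      hgc.comp (measurable_id.prodMk measurable_const)
    have hm : Measurable (fun y : Fin n → X => ∫ a, g (Fin.cons a y) ∂μ) :=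
      (hgc.stronglyMeasurable.integral_prod_left (μ := μ)).measurable
    have hb : ∀ y : Fin n → X, |∫ a, g (Fin.cons a y) ∂μ| ≤ B := fun y =>
      abs_integral_bdd fun a => hB _
    have hI := ih (fun y => ∫ a, g (Fin.cons a y) ∂μ) hm hb (by
      intro y i a
      rw [← integral_sub (integrable_bdd (hgy _) fun _ => hB _)
        (integrable_bdd (hgy _) fun _ => hB _)]
      refine abs_integral_bdd fun t => ?_
      rw [Fin.cons_update]
      exact hc _ _ _)
    rw [← integral_succ μ n hg (integrable_bdd hg hB)] at hI
    rw [integral_succ μ n (g := fun x => Real.exp (g x)) (by fun_prop) (integrable_exp_bdd hg hB)]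
    calc _ ≤ ∫ y, Real.exp (∫ a, g (Fin.cons a y) ∂μ) * Real.exp (c ^ 2 / 8)
            ∂(Measure.pi fun _ : Fin n => μ) := by
          refine integral_mono_of_nonneg
            (Filter.Eventually.of_forall fun y => integral_nonneg fun a => (Real.exp_pos _).le)
            ((integrable_exp_bdd hm hb).mul_const _) (Filter.Eventually.of_forall fun y => ?_)
          dsimp only
          rw [← Real.exp_add]
          refine hoeffding_osc μ (hgy y) fun a b => ?_
          have := hc (Fin.cons b y) 0 a
          rwa [Fin.update_cons_zero] at this
      _ ≤ _ := by
          rw [integral_mul_const]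
          refine (mul_le_mul_of_nonneg_right hI (Real.exp_pos _).le).trans ?_
          rw [← Real.exp_add]
          refine Real.exp_le_exp.2 (le_of_eq ?_)
          push_cast; ring

lemma abs_iSup_bdd {ι : Type*} [Nonempty ι] {u : ι → ℝ} {B : ℝ} (h : ∀ j, |u j| ≤ B) :
    |⨆ j, u j| ≤ B := by
  have hb : BddAbove (Set.range u) := ⟨B, by rintro _ ⟨j, rfl⟩; exact le_of_abs_le (h j)⟩
  obtain ⟨j0⟩ := ‹Nonempty ι›
  have : Nonempty ι := ⟨j0⟩
  rw [abs_le]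
  exact ⟨(neg_le_of_abs_le (h j0)).trans (le_ciSup hb j0), ciSup_le fun j => le_of_abs_le (h j)⟩

lemma bddAbove_of_abs {ι : Type*} {u : ι → ℝ} {B : ℝ} (h : ∀ j, |u j| ≤ B) :
    BddAbove (Set.range u) :=
  ⟨B, by rintro _ ⟨j, rfl⟩; exact le_of_abs_le (h j)⟩

lemma iSup_sub_iSup_le {ι : Type*} [Nonempty ι] {u v : ι → ℝ} {B c : ℝ}
    (hu : ∀ j, |u j| ≤ B) (hv : ∀ j, |v j| ≤ B) (h : ∀ j, |u j - v j| ≤ c) :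
    |(⨆ j, u j) - ⨆ j, v j| ≤ c := by
  have h1 : (⨆ j, u j) ≤ (⨆ j, v j) + c := ciSup_le fun j => by
    have := le_ciSup (bddAbove_of_abs hv) j
    have := le_of_abs_le (h j)
    linarith
  have h2 : (⨆ j, v j) ≤ (⨆ j, u j) + c := ciSup_le fun j => by
    have := le_ciSup (bddAbove_of_abs hu) j
    have := neg_le_of_abs_le (h j)
    linarith
  rw [abs_le]
  constructor <;> linarith

lemma abs_avg_le {m : ℕ} (hm : 0 < m) {w : Fin m → ℝ} {B : ℝ} (h : ∀ i, |w i| ≤ B) :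
    |(m : ℝ)⁻¹ * ∑ i, w i| ≤ B := by
  have hm' : (0 : ℝ) < m := by exact_mod_cast hm
  rw [abs_mul, abs_of_pos (inv_pos.2 hm'), inv_mul_le_iff₀ hm']
  refine (Finset.abs_sum_le_sum_abs _ _).trans ((Finset.sum_le_sum fun i _ => h i).trans ?_)
  simp

lemma abs_avg_update {X : Type*} {m : ℕ} (w : Fin m → X → ℝ) {c : ℝ}
    (h : ∀ i a b, |w i a - w i b| ≤ c) (x : Fin m → X) (i : Fin m) (a : X) :
    |(m : ℝ)⁻¹ * ∑ k, w k (Function.update x i a k) - (m : ℝ)⁻¹ * ∑ k, w k (x k)| ≤ c / m := by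
  have hm' : (0 : ℝ) < m := by exact_mod_cast i.pos
  rw [← mul_sub, ← Finset.sum_sub_distrib, Finset.sum_eq_single i]
  · rw [Function.update_self, abs_mul, abs_of_pos (inv_pos.2 hm'), inv_mul_eq_div]
    exact div_le_div_of_nonneg_right (h _ _ _) hm'.le
  · intro k _ hk
    rw [Function.update_of_ne hk, sub_self]
  · simp

/-- The sign attached to a boolean. -/
noncomputable def sg (b : Bool) : ℝ := if b then (1 : ℝ) else -1

lemma sg_not (b : Bool) : sg (!b) = - sg b := by cases b <;> simp [sg]

lemma abs_sg (b : Bool) : |sg b| = 1 := by cases b <;> simp [sg]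

/-- Signed supremum. -/
noncomputable def U {X ι : Type*} {m : ℕ} (f : ι → X → ℝ) (σ : Fin m → Bool) (x : Fin m → X) : ℝ :=
  ⨆ j, (m : ℝ)⁻¹ * ∑ i, sg (σ i) * f j (x i)

/-- One-sided uniform deviation. -/
noncomputable def Phi {X ι : Type*} [MeasurableSpace X] (μ : Measure X) {m : ℕ} (f : ι → X → ℝ)
    (x : Fin m → X) : ℝ :=
  ⨆ j, (∫ t, f j t ∂μ - (m : ℝ)⁻¹ * ∑ i, f j (x i))

/-- Supremum of the difference of two empirical means. -/
noncomputable def S {X ι : Type*} {m : ℕ} (f : ι → X → ℝ) (z : Fin m → X × X) : ℝ :=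
  ⨆ j, (m : ℝ)⁻¹ * ∑ i, (f j (z i).1 - f j (z i).2)

section
variable {X ι : Type*} [MeasurableSpace X] [Countable ι] [Nonempty ι] {m : ℕ}
  (μ : Measure X) [IsProbabilityMeasure μ] {M : ℝ} {f : ι → X → ℝ}

lemma abs_term (hr : ∀ j t, f j t ∈ Set.Icc 0 M) (b : Bool) (j : ι) (t : X) :
    |sg b * f j t| ≤ M := by
  rw [abs_mul, abs_sg, one_mul, abs_of_nonneg (hr j t).1]
  exact (hr j t).2

lemma abs_f (hr : ∀ j t, f j t ∈ Set.Icc 0 M) (j : ι) (t : X) : |f j t| ≤ M := by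
  rw [abs_of_nonneg (hr j t).1]
  exact (hr j t).2

lemma abs_f_sub (hr : ∀ j t, f j t ∈ Set.Icc 0 M) (j : ι) (s t : X) : |f j s - f j t| ≤ M := by
  have h1 := hr j s
  have h2 := hr j t
  rw [abs_le]
  constructor <;> linarith [h1.1, h1.2, h2.1, h2.2]

lemma U_meas (hf : ∀ j, Measurable (f j)) (σ : Fin m → Bool) : Measurable (U f σ) := by
  refine Measurable.iSup fun j => ?_
  have := hf j
  fun_prop

lemma Phi_meas (hf : ∀ j, Measurable (f j)) : Measurable (Phi (m := m) μ f) := by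
  refine Measurable.iSup fun j => ?_
  have := hf j
  fun_prop

lemma S_meas (hf : ∀ j, Measurable (f j)) : Measurable (S (m := m) f) := by
  refine Measurable.iSup fun j => ?_
  have := hf j
  fun_prop

lemma U_bdd (hm : 0 < m) (hr : ∀ j t, f j t ∈ Set.Icc 0 M) (σ : Fin m → Bool) (x : Fin m → X) :
    |U f σ x| ≤ M :=
  abs_iSup_bdd fun j => abs_avg_le hm fun i => abs_term hr _ _ _

lemma Phi_term (hm : 0 < m) (hr : ∀ j t, f j t ∈ Set.Icc 0 M) (x : Fin m → X) (j : ι) :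
    |∫ t, f j t ∂μ - (m : ℝ)⁻¹ * ∑ i, f j (x i)| ≤ 2 * M := by
  refine (abs_sub _ _).trans ?_
  have h1 := abs_integral_bdd (P := μ) (abs_f hr j)
  have h2 := abs_avg_le hm (w := fun i => f j (x i)) fun i => abs_f hr j (x i)
  linarith

lemma Phi_bdd (hm : 0 < m) (hr : ∀ j t, f j t ∈ Set.Icc 0 M) (x : Fin m → X) :
    |Phi μ f x| ≤ 2 * M :=
  abs_iSup_bdd fun j => Phi_term μ hm hr x j

lemma S_term (hm : 0 < m) (hr : ∀ j t, f j t ∈ Set.Icc 0 M) (z : Fin m → X × X) (j : ι) :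
    |(m : ℝ)⁻¹ * ∑ i, (f j (z i).1 - f j (z i).2)| ≤ M :=
  abs_avg_le hm fun i => abs_f_sub hr j _ _

lemma S_bdd (hm : 0 < m) (hr : ∀ j t, f j t ∈ Set.Icc 0 M) (z : Fin m → X × X) :
    |S f z| ≤ M :=
  abs_iSup_bdd fun j => S_term hm hr z j

lemma U_diff (hm : 0 < m) (hr : ∀ j t, f j t ∈ Set.Icc 0 M) (σ : Fin m → Bool) (x : Fin m → X)
    (i : Fin m) (a : X) : |U f σ (Function.update x i a) - U f σ x| ≤ M / m := by
  refine iSup_sub_iSup_le (B := M) (fun j => abs_avg_le hm fun i => abs_term hr _ _ _)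
    (fun j => abs_avg_le hm fun i => abs_term hr _ _ _) fun j => ?_
  refine abs_avg_update (fun k t => sg (σ k) * f j t) (fun k s t => ?_) x i a
  rw [← mul_sub, abs_mul, abs_sg, one_mul]
  exact abs_f_sub hr _ _ _

lemma Phi_diff (hm : 0 < m) (hr : ∀ j t, f j t ∈ Set.Icc 0 M) (x : Fin m → X)
    (i : Fin m) (a : X) : |Phi μ f (Function.update x i a) - Phi μ f x| ≤ M / m := by
  refine iSup_sub_iSup_le (Phi_term μ hm hr _) (Phi_term μ hm hr _) fun j => ?_
  rw [sub_sub_sub_cancel_left, abs_sub_comm]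
  exact abs_avg_update (fun _ t => f j t) (fun k s t => abs_f_sub hr _ _ _) x i a

lemma integral_Phi_le (hm : 0 < m) (hf : ∀ j, Measurable (f j))
    (hr : ∀ j t, f j t ∈ Set.Icc 0 M) :
    ∫ x, Phi μ f x ∂(Measure.pi fun _ : Fin m => μ) ≤
      ∫ z, S f z ∂(Measure.pi fun _ : Fin m => μ.prod μ) := by
  have hp := (measurePreserving_arrowProdEquivProdArrow X X (Fin m) (fun _ => μ) (fun _ => μ)).symm
  have hSm := (S_meas (m := m) hf)
  have hcm : Measurable (fun p : (Fin m → X) × (Fin m → X) =>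
      (fun i => (p.1 i, p.2 i) : Fin m → X × X)) := by fun_prop
  have hm2 : Measurable (fun p : (Fin m → X) × (Fin m → X) => S f (fun i => (p.1 i, p.2 i))) :=
    hSm.comp hcm
  have h1 : ∫ z, S f z ∂(Measure.pi fun _ : Fin m => μ.prod μ) =
      ∫ p : (Fin m → X) × (Fin m → X), S f (fun i => (p.1 i, p.2 i))
        ∂((Measure.pi fun _ : Fin m => μ).prod (Measure.pi fun _ : Fin m => μ)) :=
    (hp.integral_comp' (S f)).symm
  rw [h1, integral_prod_symm _ (integrable_bdd hm2 fun p => S_bdd hm hr _)]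
  refine integral_mono (integrable_bdd (Phi_meas μ hf) (Phi_bdd μ hm hr))
    (integrable_bdd (B := M)
      (hm2.stronglyMeasurable.integral_prod_left (μ := Measure.pi fun _ : Fin m => μ)).measurable
      fun y => abs_integral_bdd fun x => S_bdd hm hr _) fun y => ?_
  refine ciSup_le fun j => ?_
  have hev : ∀ i : Fin m, ∫ x, f j (x i) ∂(Measure.pi fun _ : Fin m => μ) = ∫ t, f j t ∂μ := by
    intro i
    exact integral_comp_eval (μ := fun _ : Fin m => μ) (i := i) (hf j).aestronglyMeasurable
  have hin : ∀ i : Fin m, Integrable (fun x : Fin m → X => f j (x i))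
      (Measure.pi fun _ : Fin m => μ) := fun i =>
    integrable_bdd ((hf j).comp (measurable_pi_apply i)) fun x => abs_f hr _ _
  have hm' : (m : ℝ) ≠ 0 := by exact_mod_cast hm.ne'
  have heq : ∫ t, f j t ∂μ - (m : ℝ)⁻¹ * ∑ i, f j (y i) =
      ∫ x, (m : ℝ)⁻¹ * ∑ i, (f j (x i) - f j (y i)) ∂(Measure.pi fun _ : Fin m => μ) := by
    rw [integral_const_mul, integral_finsetSum (f := fun i (x : Fin m → X) => f j (x i) - f j (y i)) _
      fun i _ => (hin i).sub (integrable_const _)]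
    simp_rw [fun i => integral_sub (hin i) (integrable_const (f j (y i))), hev]
    rw [Finset.sum_sub_distrib]
    simp
    field_simp
  rw [heq]
  have hfj := hf j
  refine integral_mono (integrable_bdd (B := M) (by fun_prop) fun x =>
    abs_avg_le hm fun i => abs_f_sub hr _ _ _)
    (integrable_bdd (hm2.comp (measurable_id.prodMk measurable_const)) fun x => S_bdd hm hr _)
    fun x => ?_
  exact le_ciSup (bddAbove_of_abs (S_term hm hr (fun i => (x i, y i)))) j

lemma integral_S_le (hm : 0 < m) (hf : ∀ j, Measurable (f j))
    (hr : ∀ j t, f j t ∈ Set.Icc 0 M) (σ : Fin m → Bool) :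
    ∫ z, S f z ∂(Measure.pi fun _ : Fin m => μ.prod μ) ≤
      ∫ x, U f σ x ∂(Measure.pi fun _ : Fin m => μ) +
      ∫ x, U f (fun i => !(σ i)) x ∂(Measure.pi fun _ : Fin m => μ) := by
  have hsw : MeasurePreserving
      (fun (z : Fin m → X × X) i => (if σ i then id else Prod.swap : X × X → X × X) (z i))
      (Measure.pi fun _ : Fin m => μ.prod μ) (Measure.pi fun _ : Fin m => μ.prod μ) := by
    refine measurePreserving_pi _ _ fun i => ?_
    cases σ i
    · simpa using Measure.measurePreserving_swap
    · simpa using MeasurePreserving.id _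
  have h1 : MeasurePreserving (fun (z : Fin m → X × X) i => (z i).1)
      (Measure.pi fun _ : Fin m => μ.prod μ) (Measure.pi fun _ : Fin m => μ) :=
    measurePreserving_pi _ _ fun i => measurePreserving_fst
  have h2 : MeasurePreserving (fun (z : Fin m → X × X) i => (z i).2)
      (Measure.pi fun _ : Fin m => μ.prod μ) (Measure.pi fun _ : Fin m => μ) :=
    measurePreserving_pi _ _ fun i => measurePreserving_snd
  have key : ∀ {Y : Type _} {Z : Type _} [MeasurableSpace Y] [MeasurableSpace Z] {P : Measure Y}
      {Q : Measure Z} {e : Y → Z} (_ : MeasurePreserving e P Q) {g : Z → ℝ} (_ : Measurable g),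
      ∫ z, g z ∂Q = ∫ y, g (e y) ∂P := by
    intro Y Z _ _ P Q e he g hg
    rw [← he.map_eq, integral_map he.measurable.aemeasurable hg.aestronglyMeasurable]
  have hU1 := U_meas (m := m) hf σ
  have hU2 := U_meas (m := m) hf (fun i => !(σ i))
  have i1 : Integrable (fun z : Fin m → X × X => U f σ fun i => (z i).1)
      (Measure.pi fun _ : Fin m => μ.prod μ) :=
    integrable_bdd (hU1.comp h1.measurable) fun z => U_bdd hm hr _ _
  have i2 : Integrable (fun z : Fin m → X × X => U f (fun i => !(σ i)) fun i => (z i).2)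
      (Measure.pi fun _ : Fin m => μ.prod μ) :=
    integrable_bdd (hU2.comp h2.measurable) fun z => U_bdd hm hr _ _
  rw [key hsw (S_meas hf), key h1 hU1, key h2 hU2, ← integral_add i1 i2]
  refine integral_mono
    (integrable_bdd ((S_meas hf).comp hsw.measurable) fun z => S_bdd hm hr _)
    (i1.add i2) fun z => ?_
  refine ciSup_le fun j => ?_
  have e1 := le_ciSup (bddAbove_of_abs (u := fun j => (m : ℝ)⁻¹ * ∑ i, sg (σ i) * f j (z i).1)
    fun j => abs_avg_le hm fun i => abs_term hr _ _ _) j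
  have e2 := le_ciSup (bddAbove_of_abs (u := fun j => (m : ℝ)⁻¹ * ∑ i, sg (!(σ i)) * f j (z i).2)
    fun j => abs_avg_le hm fun i => abs_term hr _ _ _) j
  refine le_trans (le_of_eq ?_) (add_le_add e1 e2)
  dsimp only
  rw [← mul_add, ← Finset.sum_add_distrib]
  congr 1
  refine Finset.sum_congr rfl fun i _ => ?_
  rw [sg_not]
  cases σ i <;> simp [sg] <;> ring

/-- Empirical Rademacher complexity of an indexed family. -/
noncomputable def rad {X ι : Type*} {m : ℕ} (f : ι → X → ℝ) (x : Fin m → X) : ℝ :=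
  (∑ σ : Fin m → Bool, U f σ x) / 2 ^ m

lemma abs_rad_aux {w : (Fin m → Bool) → ℝ} {B : ℝ} (h : ∀ σ, |w σ| ≤ B) :
    |(∑ σ, w σ) / 2 ^ m| ≤ B := by
  have h2 : (0 : ℝ) < 2 ^ m := by positivity
  rw [abs_div, abs_of_pos h2, div_le_iff₀ h2]
  refine (Finset.abs_sum_le_sum_abs _ _).trans ((Finset.sum_le_sum fun i _ => h i).trans ?_)
  simp [mul_comm]

lemma rad_meas (hf : ∀ j, Measurable (f j)) : Measurable (rad (m := m) f) := by
  refine Measurable.div_const (Finset.measurable_sum _ fun σ _ => U_meas hf σ) _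

lemma rad_bdd (hm : 0 < m) (hr : ∀ j t, f j t ∈ Set.Icc 0 M) (x : Fin m → X) : |rad f x| ≤ M :=
  abs_rad_aux fun σ => U_bdd hm hr σ x

lemma rad_diff (hm : 0 < m) (hr : ∀ j t, f j t ∈ Set.Icc 0 M) (x : Fin m → X)
    (i : Fin m) (a : X) : |rad f (Function.update x i a) - rad f x| ≤ M / m := by
  rw [rad, rad, ← sub_div, ← Finset.sum_sub_distrib]
  exact abs_rad_aux fun σ => U_diff hm hr σ x i a

lemma symmetrization (hm : 0 < m) (hf : ∀ j, Measurable (f j))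
    (hr : ∀ j t, f j t ∈ Set.Icc 0 M) :
    ∫ x, Phi μ f x ∂(Measure.pi fun _ : Fin m => μ) ≤
      2 * ∫ x, rad f x ∂(Measure.pi fun _ : Fin m => μ) := by
  refine (integral_Phi_le μ hm hf hr).trans ?_
  have h2 : (0 : ℝ) < 2 ^ m := by positivity
  have h := Finset.sum_le_sum fun (σ : Fin m → Bool) (_ : σ ∈ Finset.univ) =>
    integral_S_le μ hm hf hr σ
  have hbij : ∑ σ : Fin m → Bool,
      ∫ x, U f (fun i => !(σ i)) x ∂(Measure.pi fun _ : Fin m => μ) =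
      ∑ σ : Fin m → Bool, ∫ x, U f σ x ∂(Measure.pi fun _ : Fin m => μ) := by
    have hinv : Function.Involutive (fun (σ : Fin m → Bool) i => !(σ i)) := fun σ => by simp
    exact Function.Bijective.sum_comp hinv.bijective
      (fun σ => ∫ x, U f σ x ∂(Measure.pi fun _ : Fin m => μ))
  rw [Finset.sum_add_distrib, hbij] at h
  have hrad : ∫ x, rad f x ∂(Measure.pi fun _ : Fin m => μ) =
      (∑ σ : Fin m → Bool, ∫ x, U f σ x ∂(Measure.pi fun _ : Fin m => μ)) / 2 ^ m := by
    unfold rad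
    rw [integral_div, integral_finsetSum _ fun σ _ =>
      integrable_bdd (U_meas hf σ) (U_bdd hm hr σ)]
  rw [hrad, ← mul_div_assoc, le_div_iff₀ h2]
  simp at h
  linarith

lemma tail (hM : 0 < M) (hm : 0 < m) (hf : ∀ j, Measurable (f j))
    (hr : ∀ j t, f j t ∈ Set.Icc 0 M) {L : ℝ} (hL : 0 ≤ L) :
    (Measure.pi fun _ : Fin m => μ).real
      {x | 3 * M * Real.sqrt (L / (2 * m)) ≤ Phi μ f x - 2 * rad f x} ≤ Real.exp (-L) := by
  have hm' : (0 : ℝ) < m := by exact_mod_cast hm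
  set ε := 3 * M * Real.sqrt (L / (2 * m)) with hε
  have hε2 : ε ^ 2 = 9 * M ^ 2 * (L / (2 * m)) := by
    rw [hε, mul_pow, Real.sq_sqrt (by positivity)]; ring
  have hε0 : 0 ≤ ε := by positivity
  set t := 4 * ε * m / (9 * M ^ 2) with ht
  have ht0 : 0 ≤ t := by positivity
  have hG : Measurable (fun x : Fin m → X => Phi μ f x - 2 * rad f x) :=
    (Phi_meas μ hf).sub ((rad_meas hf).const_mul 2)
  have hGb : ∀ x : Fin m → X, |Phi μ f x - 2 * rad f x| ≤ 4 * M := fun x => by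
    have h1 := abs_le.1 (Phi_bdd μ hm hr x)
    have h2 := abs_le.1 (rad_bdd hm hr x)
    rw [abs_le]; constructor <;> linarith [h1.1, h1.2, h2.1, h2.2]
  have hb : ∀ x : Fin m → X, |t * (Phi μ f x - 2 * rad f x)| ≤ t * (4 * M) := fun x => by
    rw [abs_mul, abs_of_nonneg ht0]
    exact mul_le_mul_of_nonneg_left (hGb x) ht0
  have hmc := mcdiarmid μ (t * (3 * (M / m))) (t * (4 * M)) m
    (fun x => t * (Phi μ f x - 2 * rad f x)) (hG.const_mul t) hb (by
      intro x i a
      rw [← mul_sub, abs_mul, abs_of_nonneg ht0]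
      refine mul_le_mul_of_nonneg_left ?_ ht0
      have h1 := abs_le.1 (Phi_diff μ hm hr x i a)
      have h2 := abs_le.1 (rad_diff hm hr x i a)
      rw [abs_le]; constructor <;> linarith [h1.1, h1.2, h2.1, h2.2])
  have hmean : ∫ x, t * (Phi μ f x - 2 * rad f x) ∂(Measure.pi fun _ : Fin m => μ) ≤ 0 := by
    rw [integral_const_mul, integral_sub (integrable_bdd (Phi_meas μ hf) (Phi_bdd μ hm hr))
      ((integrable_bdd (rad_meas hf) (rad_bdd hm hr)).const_mul 2), integral_const_mul]
    have := symmetrization μ hm hf hr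
    exact mul_nonpos_of_nonneg_of_nonpos ht0 (by linarith)
  have hch := ProbabilityTheory.measure_ge_le_exp_mul_mgf
    (μ := Measure.pi fun _ : Fin m => μ) (X := fun x => Phi μ f x - 2 * rad f x) ε ht0
    (integrable_exp_bdd (hG.const_mul t) hb)
  refine hch.trans ?_
  refine (mul_le_mul_of_nonneg_left hmc (Real.exp_pos _).le).trans ?_
  rw [← Real.exp_add]
  refine Real.exp_le_exp.2 ?_
  have hcalc : -t * ε + m * ((t * (3 * (M / m))) ^ 2 / 8) = -L := by
    have : -t * ε + m * ((t * (3 * (M / m))) ^ 2 / 8) = - (2 * m / (9 * M ^ 2)) * ε ^ 2 := by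
      rw [ht]; field_simp; ring
    rw [this, hε2]; field_simp
  linarith

end

end RadAux

theorem rademacher_generalization_bound {X : Type*} [MeasurableSpace X]
    (μ : Measure X) [IsProbabilityMeasure μ]
    (M : ℝ) (hM : 0 < M) (F : Set (X → ℝ)) (hF_count : F.Countable)
    (hF_meas : ∀ f ∈ F, Measurable f)
    (hF_range : ∀ f ∈ F, ∀ t, f t ∈ Set.Icc 0 M)
    (m : ℕ) (hm : 0 < m) (δ : ℝ) (hδ : δ ∈ Set.Ioo (0 : ℝ) 1) :
    ENNReal.ofReal (1 - δ) ≤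
      (Measure.pi fun _ : Fin m => μ)
        {x : Fin m → X | ∀ f ∈ F,
          (∫ t, f t ∂μ) ≤ (m : ℝ)⁻¹ * ∑ i, f (x i) + 2 * rademacher m x F +
            3 * M * Real.sqrt (Real.log (2 / δ) / (2 * m))} := by
  obtain ⟨hδ0, hδ1⟩ := hδ
  rcases F.eq_empty_or_nonempty with rfl | hne
  · simp only [Set.mem_empty_iff_false, false_implies, implies_true, Set.ofPred_true, measure_univ]
    exact ENNReal.ofReal_le_one.2 (by linarith)
  have : Countable F := hF_count.to_subtype
  have : Nonempty F := hne.to_subtype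
  set f : F → X → ℝ := fun j => j.1 with hfdef
  have hf : ∀ j, Measurable (f j) := fun j => hF_meas j.1 j.2
  have hr : ∀ j t, f j t ∈ Set.Icc 0 M := fun j t => hF_range j.1 j.2 t
  have hrad : ∀ x : Fin m → X, rademacher m x F = RadAux.rad f x := by
    intro x
    unfold rademacher RadAux.rad RadAux.U
    simp only [sSup_image', RadAux.sg, hfdef]
  have hL : 0 ≤ Real.log (2 / δ) := Real.log_nonneg (by rw [le_div_iff₀ hδ0]; linarith)
  have ht := RadAux.tail μ (m := m) hM hm hf hr hL
  rw [Real.exp_neg, Real.exp_log (by positivity), inv_div] at ht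
  set A := {x : Fin m → X | 3 * M * Real.sqrt (Real.log (2 / δ) / (2 * m)) ≤
    RadAux.Phi μ f x - 2 * RadAux.rad f x} with hA
  have hAm : MeasurableSet A := measurableSet_le measurable_const
    ((RadAux.Phi_meas μ hf).sub ((RadAux.rad_meas hf).const_mul 2))
  have hsub : Aᶜ ⊆ {x : Fin m → X | ∀ f ∈ F,
          (∫ t, f t ∂μ) ≤ (m : ℝ)⁻¹ * ∑ i, f (x i) + 2 * rademacher m x F +
            3 * M * Real.sqrt (Real.log (2 / δ) / (2 * m))} := by
    intro x hx g hg
    have hx' : RadAux.Phi μ f x - 2 * RadAux.rad f x <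
      3 * M * Real.sqrt (Real.log (2 / δ) / (2 * m)) := not_le.1 hx
    have h1 := le_ciSup (RadAux.bddAbove_of_abs (RadAux.Phi_term μ hm hr x)) ⟨g, hg⟩
    change ∫ t, g t ∂μ - (m : ℝ)⁻¹ * ∑ i, g (x i) ≤ RadAux.Phi μ f x at h1
    rw [hrad]
    linarith
  refine le_trans ?_ (measure_mono hsub)
  rw [← ofReal_measureReal, probReal_compl_eq_one_sub hAm]
  exact ENNReal.ofReal_le_ofReal (by linarith)
end

section
/- Let X be a measurable space, μ a probability measure on X, M > 0, and F a countable class of measurable functions f : X → [0, M]. Let x_1, …, x_m be drawn i.i.d. from μ. Then the expected value over the sample of the worst-case deviation between true and empirical means is bounded by twice the expected empirical Rademacher complexity: E_{x∼μ^m}[ sup_{f ∈ F} ( E_μ[f] − (1/m) Σ_{i=1}^m f(x_i) ) ] ≤ 2·E_{x∼μ^m}[ R̂_x(F) ]. -/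
open MeasureTheory

lemma sym_sup_integrable {Ω α : Type*} [MeasurableSpace Ω] (P : Measure Ω) [IsFiniteMeasure P]
    (F : Set α) (hc : F.Countable) (hne : F.Nonempty) (g : α → Ω → ℝ)
    (hg : ∀ f ∈ F, Measurable (g f)) (C : ℝ) (hC : ∀ f ∈ F, ∀ x, |g f x| ≤ C) :
    Integrable (fun x => sSup ((fun f => g f x) '' F)) P := by
  have hcF : Countable F := hc.to_subtype
  have hneF : Nonempty F := hne.to_subtype
  have hmeas : Measurable (fun x => sSup ((fun f => g f x) '' F)) := by
    simp only [sSup_image']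
    exact Measurable.iSup (fun f => hg f.1 f.2)
  refine Integrable.of_bound hmeas.aestronglyMeasurable C (Filter.Eventually.of_forall fun x => ?_)
  rw [Real.norm_eq_abs, abs_le]
  obtain ⟨f0, hf0⟩ := hne
  constructor
  · refine le_trans (abs_le.1 (hC f0 hf0 x)).1 (le_csSup ⟨C, ?_⟩ ⟨f0, hf0, rfl⟩)
    rintro _ ⟨f, hf, rfl⟩
    exact (abs_le.1 (hC f hf x)).2
  · refine csSup_le ⟨_, f0, hf0, rfl⟩ ?_
    rintro _ ⟨f, hf, rfl⟩
    exact (abs_le.1 (hC f hf x)).2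

lemma sym_le_sup {α : Type*} (F : Set α) (g : α → ℝ) (C : ℝ) (hC : ∀ f ∈ F, |g f| ≤ C)
    (f : α) (hf : f ∈ F) : g f ≤ sSup (g '' F) := by
  refine le_csSup ⟨C, ?_⟩ ⟨f, hf, rfl⟩
  rintro _ ⟨f, hf, rfl⟩
  exact (abs_le.1 (hC f hf)).2

/-- signed empirical mean -/
noncomputable def symD {X : Type*} (m : ℕ) (σ : Fin m → Bool) (f : X → ℝ) (x : Fin m → X) : ℝ :=
  (m : ℝ)⁻¹ * ∑ i, (if σ i then (1 : ℝ) else -1) * f (x i)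

lemma symD_abs {X : Type*} (m : ℕ) (hm : 0 < m) (M : ℝ) (σ : Fin m → Bool) (f : X → ℝ)
    (hf : ∀ t, f t ∈ Set.Icc 0 M) (x : Fin m → X) : |symD m σ f x| ≤ M := by
  have hm' : (0 : ℝ) < m := by exact_mod_cast hm
  unfold symD
  rw [abs_mul, abs_of_pos (inv_pos.2 hm'), inv_mul_le_iff₀ hm']
  refine (Finset.abs_sum_le_sum_abs _ _).trans ?_
  calc _ ≤ ∑ i : Fin m, M := by
        refine Finset.sum_le_sum fun i _ => ?_
        have := hf (x i)
        rw [abs_le]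
        split_ifs <;> constructor <;> linarith [this.1, this.2]
    _ = m * M := by simp

lemma symD_meas {X : Type*} [MeasurableSpace X] (m : ℕ) (σ : Fin m → Bool) (f : X → ℝ)
    (hf : Measurable f) : Measurable (symD m σ f) := by
  unfold symD
  fun_prop

/-- coordinatewise swap -/
def symT {X : Type*} {m : ℕ} (σ : Fin m → Bool) (z : (Fin m → X) × (Fin m → X)) :
    (Fin m → X) × (Fin m → X) :=
  (fun i => if σ i then z.1 i else z.2 i, fun i => if σ i then z.2 i else z.1 i)

lemma symT_mp {X : Type*} [MeasurableSpace X] (μ : Measure X) [IsProbabilityMeasure μ] {m : ℕ}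
    (σ : Fin m → Bool) :
    MeasurePreserving (symT (X := X) σ)
      ((Measure.pi fun _ : Fin m => μ).prod (Measure.pi fun _ : Fin m => μ))
      ((Measure.pi fun _ : Fin m => μ).prod (Measure.pi fun _ : Fin m => μ)) := by
  have h1 := measurePreserving_arrowProdEquivProdArrow X X (Fin m) (fun _ => μ) (fun _ => μ)
  have h2 : MeasurePreserving (fun (z : Fin m → X × X) i => (if σ i then id else Prod.swap) (z i))
      (Measure.pi fun _ => μ.prod μ) (Measure.pi fun _ => μ.prod μ) := by
    refine measurePreserving_pi _ _ fun i => ?_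
    split_ifs
    · exact MeasurePreserving.id _
    · exact Measure.measurePreserving_swap
  have h3 := (h1.comp h2).comp h1.symm
  convert h3 using 1
  funext z
  apply Prod.ext <;> funext i <;>
    simp only [symT, Function.comp, MeasurableEquiv.arrowProdEquivProdArrow,
      Equiv.arrowProdEquivProdArrow] <;> by_cases h : σ i <;> simp [h]

theorem symmetrization_bound {X : Type*} [MeasurableSpace X]
    (μ : Measure X) [IsProbabilityMeasure μ]
    (M : ℝ) (hM : 0 < M) (F : Set (X → ℝ)) (hF_count : F.Countable)
    (hF_meas : ∀ f ∈ F, Measurable f)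
    (hF_range : ∀ f ∈ F, ∀ t, f t ∈ Set.Icc 0 M)
    (m : ℕ) (hm : 0 < m) :
    ∫ x, sSup ((fun f => (∫ t, f t ∂μ) - (m : ℝ)⁻¹ * ∑ i, f (x i)) '' F)
        ∂(Measure.pi fun _ : Fin m => μ) ≤
      2 * ∫ x, rademacher m x F ∂(Measure.pi fun _ : Fin m => μ) := by
  rcases F.eq_empty_or_nonempty with rfl | hne
  · simp [rademacher]
  have hm' : (0 : ℝ) < m := by exact_mod_cast hm
  set P := Measure.pi fun _ : Fin m => μ with hP
  let A : (Fin m → Bool) → (Fin m → X) → ℝ := fun σ x => sSup ((fun f => symD m σ f x) '' F)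
  let one : Fin m → Bool := fun _ => true
  have hDabs : ∀ σ, ∀ f ∈ F, ∀ x, |symD m σ f x| ≤ M := fun σ f hf x =>
    symD_abs m hm M σ f (hF_range f hf) x
  have hDmeas : ∀ σ, ∀ f ∈ F, Measurable (symD m σ f) := fun σ f hf =>
    symD_meas m σ f (hF_meas f hf)
  have hDint : ∀ σ, ∀ f ∈ F, Integrable (symD m σ f) P := fun σ f hf =>
    Integrable.of_bound (hDmeas σ f hf).aestronglyMeasurable M
      (Filter.Eventually.of_forall fun x => hDabs σ f hf x)
  have hAint : ∀ σ, Integrable (A σ) P := fun σ =>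
    sym_sup_integrable P F hF_count hne (fun f x => symD m σ f x) (hDmeas σ) M (hDabs σ)
  have hone : ∀ f : X → ℝ, ∀ x, symD m one f x = (m : ℝ)⁻¹ * ∑ i, f (x i) := by
    intro f x; simp [symD, one]
  have hfint : ∀ f ∈ F, Integrable f μ := fun f hf =>
    Integrable.of_bound (hF_meas f hf).aestronglyMeasurable M
      (Filter.Eventually.of_forall fun x => by
        rw [Real.norm_eq_abs, abs_of_nonneg (hF_range f hf x).1]; exact (hF_range f hf x).2)
  have hmean : ∀ f ∈ F, ∫ y, symD m one f y ∂P = ∫ t, f t ∂μ := by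
    intro f hf
    simp only [hone]
    rw [integral_const_mul, integral_finsetSum]
    · have : ∀ i : Fin m, ∫ y, f (y i) ∂P = ∫ t, f t ∂μ := fun i =>
        integral_comp_eval (μ := fun _ : Fin m => μ) (i := i)
          (hF_meas f hf).aestronglyMeasurable
      simp [this]
      field_simp
    · intro i _
      exact (measurePreserving_eval (fun _ : Fin m => μ) i).integrable_comp_of_integrable
        (hfint f hf)
  have hEabs : ∀ f ∈ F, |∫ t, f t ∂μ| ≤ M := by
    intro f hf
    rw [← hmean f hf]
    refine (norm_integral_le_of_norm_le_const (μ := P) (f := symD m one f) (C := M)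
      (Filter.Eventually.of_forall fun x => hDabs one f hf x)).trans ?_
    simp [hP]
  let G : (Fin m → X) × (Fin m → X) → ℝ := fun z =>
    sSup ((fun f => symD m one f z.2 - symD m one f z.1) '' F)
  have hdabs : ∀ σ, ∀ f ∈ F, ∀ z : (Fin m → X) × (Fin m → X),
      |symD m σ f z.2 - symD m σ f z.1| ≤ M + M := fun σ f hf z =>
    (abs_sub _ _).trans (add_le_add (hDabs σ f hf _) (hDabs σ f hf _))
  have hdmeas : ∀ σ, ∀ f ∈ F, Measurable fun z : (Fin m → X) × (Fin m → X) =>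
      symD m σ f z.2 - symD m σ f z.1 := fun σ f hf =>
    ((hDmeas σ f hf).comp measurable_snd).sub ((hDmeas σ f hf).comp measurable_fst)
  have hGint : Integrable G (P.prod P) :=
    sym_sup_integrable (P.prod P) F hF_count hne
      (fun f z => symD m one f z.2 - symD m one f z.1) (hdmeas one) (M + M) (hdabs one)
  -- step 1
  have step1 : ∫ x, sSup ((fun f => (∫ t, f t ∂μ) - (m : ℝ)⁻¹ * ∑ i, f (x i)) '' F) ∂P
      ≤ ∫ z, G z ∂(P.prod P) := by
    rw [integral_prod _ hGint]
    simp only [← hone]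
    refine integral_mono ?_ hGint.integral_prod_left ?_
    · refine sym_sup_integrable P F hF_count hne
        (fun f x => (∫ t, f t ∂μ) - symD m one f x) (fun f hf => ?_) (M + M) ?_
      · exact measurable_const.sub (hDmeas one f hf)
      · exact fun f hf x => (abs_sub _ _).trans (add_le_add (hEabs f hf) (hDabs one f hf x))
    · intro x
      refine csSup_le (hne.image _) ?_
      rintro _ ⟨f, hf, rfl⟩
      have e : (∫ t, f t ∂μ) - symD m one f x
          = ∫ y, (symD m one f y - symD m one f x) ∂P := by
        rw [integral_sub (hDint one f hf) (integrable_const _), hmean f hf]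
        simp [hP]
      simp only [e]
      refine integral_mono ((hDint one f hf).sub (integrable_const _)) ?_ ?_
      · exact sym_sup_integrable P F hF_count hne
          (fun f y => symD m one f y - symD m one f x)
          (fun f hf => (hDmeas one f hf).sub measurable_const) (M + M)
          (fun f hf y => hdabs one f hf (x, y))
      · intro y
        exact sym_le_sup F (fun f => symD m one f y - symD m one f x) (M + M)
          (fun f hf => hdabs one f hf (x, y)) f hf
  -- step 2
  have step2 : ∀ σ : Fin m → Bool, ∫ z, G z ∂(P.prod P)
      ≤ ∫ x, A σ x ∂P + ∫ x, A (fun i => !σ i) x ∂P := by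
    intro σ
    have hT := symT_mp μ σ
    have e1 : ∫ z, G z ∂(P.prod P) = ∫ z, G (symT σ z) ∂(P.prod P) := by
      conv_lhs => rw [← hT.map_eq]
      rw [integral_map hT.measurable.aemeasurable]
      rw [hT.map_eq]
      exact hGint.aestronglyMeasurable
    have i2 : Integrable (fun z : (Fin m → X) × (Fin m → X) => A σ z.2) (P.prod P) :=
      (hAint σ).comp_snd P
    have i1 : Integrable (fun z : (Fin m → X) × (Fin m → X) => A (fun i => !σ i) z.1)
        (P.prod P) := (hAint _).comp_fst P
    have e2 : ∫ x, A σ x ∂P + ∫ x, A (fun i => !σ i) x ∂P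
        = ∫ z, (A σ z.2 + A (fun i => !σ i) z.1) ∂(P.prod P) := by
      rw [integral_add i2 i1, integral_fun_snd, integral_fun_fst]
      simp [hP]
    rw [e1, e2]
    refine integral_mono (hT.integrable_comp_of_integrable hGint) (i2.add i1) ?_
    intro z
    refine csSup_le (hne.image _) ?_
    rintro _ ⟨f, hf, rfl⟩
    have e3 : symD m one f (symT σ z).2 - symD m one f (symT σ z).1
        = symD m σ f z.2 + symD m (fun i => !σ i) f z.1 := by
      simp only [symD, ← mul_sub, ← mul_add, ← Finset.sum_sub_distrib, ← Finset.sum_add_distrib]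
      congr 1
      refine Finset.sum_congr rfl fun i _ => ?_
      by_cases h : σ i <;> simp [symT, one, h] <;> ring
    simp only [e3]
    exact add_le_add
      (sym_le_sup F (fun f => symD m σ f z.2) M (fun f hf => hDabs σ f hf _) f hf)
      (sym_le_sup F (fun f => symD m (fun i => !σ i) f z.1) M (fun f hf => hDabs _ f hf _) f hf)
  have hrad : ∫ x, rademacher m x F ∂P = (∑ σ, ∫ x, A σ x ∂P) / 2 ^ m := by
    rw [← integral_finsetSum _ (fun σ _ => hAint σ), ← integral_div]
    rfl
  have hflip : ∑ σ : Fin m → Bool, ∫ x, A (fun i => !σ i) x ∂P = ∑ σ, ∫ x, A σ x ∂P := by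
    have hinv : Function.Involutive (fun (σ : Fin m → Bool) i => !σ i) := by
      intro σ; funext i; simp
    exact Equiv.sum_comp hinv.toPerm (fun σ => ∫ x, A σ x ∂P)
  have hsum : (2 : ℝ) ^ m * ∫ z, G z ∂(P.prod P) ≤ 2 * ∑ σ, ∫ x, A σ x ∂P := by
    have := Finset.sum_le_sum (s := Finset.univ) fun σ _ => step2 σ
    rw [Finset.sum_add_distrib, hflip] at this
    simp at this
    linarith
  refine step1.trans ?_
  rw [hrad, ← mul_div_assoc, le_div_iff₀ (by positivity)]
  linarith
end

section
/- Let X be a set, x_1, …, x_m ∈ X, F a class of functions X → ℝ, and φ : ℝ → ℝ an L-Lipschitz function. Then the empirical Rademacher complexity of the composed class φ ∘ F = { x ↦ φ(f(x)) : f ∈ F } satisfies R̂_x(φ ∘ F) ≤ L · R̂_x(F). -/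
/-- A real-valued function with bounded absolute value. -/
def AbsBdd {T : Type*} (f : T → ℝ) : Prop := ∃ C, ∀ t, |f t| ≤ C

theorem AbsBdd.add {T : Type*} {f g : T → ℝ} (hf : AbsBdd f) (hg : AbsBdd g) :
    AbsBdd (fun t => f t + g t) := by
  obtain ⟨C, hC⟩ := hf
  obtain ⟨D, hD⟩ := hg
  exact ⟨C + D, fun t => (abs_add_le _ _).trans (add_le_add (hC t) (hD t))⟩

theorem AbsBdd.const_mul {T : Type*} {f : T → ℝ} (r : ℝ) (hf : AbsBdd f) :
    AbsBdd (fun t => r * f t) := by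
  obtain ⟨C, hC⟩ := hf
  refine ⟨|r| * C, fun t => ?_⟩
  rw [abs_mul]
  exact mul_le_mul_of_nonneg_left (hC t) (abs_nonneg r)

theorem AbsBdd.sum {T ι : Type*} (s : Finset ι) {f : T → ι → ℝ}
    (hf : ∀ i, AbsBdd (fun t => f t i)) : AbsBdd (fun t => ∑ i ∈ s, f t i) := by
  choose C hC using hf
  exact ⟨∑ i ∈ s, C i, fun t =>
    (Finset.abs_sum_le_sum_abs _ _).trans (Finset.sum_le_sum fun i _ => hC i t)⟩

theorem AbsBdd.bddAbove {T : Type*} {f : T → ℝ} (hf : AbsBdd f) :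
    BddAbove (Set.range f) := by
  obtain ⟨C, hC⟩ := hf
  refine ⟨C, ?_⟩
  rintro _ ⟨t, rfl⟩
  exact (le_abs_self _).trans (hC t)

theorem absBdd_coord {T : Type*} {m : ℕ} (g : T → Fin m → ℝ)
    (h : ∀ σ : Fin m → Bool,
      ∃ M, ∀ t, ∑ i, (if σ i then (1 : ℝ) else -1) * g t i ≤ M) (j : Fin m) :
    AbsBdd (fun t => g t j) := by
  choose M hM using h
  refine ⟨∑ σ, |M σ|, fun t => ?_⟩
  have h1 := hM (fun i => decide (0 ≤ g t i)) t
  have h2 : ∀ i, (if decide (0 ≤ g t i) = true then (1 : ℝ) else -1) * g t i = |g t i| := by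
    intro i
    by_cases hi : 0 ≤ g t i
    · simp [hi, abs_of_nonneg hi]
    · simp [hi, abs_of_neg (not_le.mp hi)]
  simp only [h2] at h1
  calc |g t j| ≤ ∑ i, |g t i| :=
        Finset.single_le_sum (f := fun i => |g t i|) (fun i _ => abs_nonneg _) (Finset.mem_univ j)
    _ ≤ _ := h1
    _ ≤ _ := le_abs_self _
    _ ≤ ∑ σ, |M σ| :=
        Finset.single_le_sum (f := fun σ => |M σ|) (fun i _ => abs_nonneg _) (Finset.mem_univ _)

theorem contraction_step {T : Type*} [Nonempty T] (d a b : T → ℝ)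
    (hd : AbsBdd d) (ha : AbsBdd a)
    (hab : ∀ t t', |b t - b t'| ≤ |a t - a t'|) :
    (⨆ t, (d t + 1 * b t)) + (⨆ t, (d t + (-1) * b t)) ≤
      (⨆ t, (d t + 1 * a t)) + (⨆ t, (d t + (-1) * a t)) := by
  have h1 := (hd.add (ha.const_mul 1)).bddAbove
  have h2 := (hd.add (ha.const_mul (-1))).bddAbove
  refine ciSup_add_ciSup_le fun t t' => ?_
  have e1 := le_ciSup h1 t
  have e2 := le_ciSup h2 t
  have e3 := le_ciSup h1 t'
  have e4 := le_ciSup h2 t'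
  have e5 := (le_abs_self _).trans (hab t t')
  rcases abs_cases (a t - a t') with ⟨h, _⟩ | ⟨h, _⟩ <;> rw [h] at e5 <;> linarith

theorem contraction_aux {T : Type*} [Nonempty T] (n : ℕ) : ∀ (c : T → ℝ) (a b : T → Fin n → ℝ),
    AbsBdd c → (∀ i, AbsBdd (fun t => a t i)) → (∀ i, AbsBdd (fun t => b t i)) →
    (∀ i t t', |b t i - b t' i| ≤ |a t i - a t' i|) →
    ∑ σ : Fin n → Bool, ⨆ t, (c t + ∑ i, (if σ i then (1 : ℝ) else -1) * b t i) ≤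
      ∑ σ : Fin n → Bool, ⨆ t, (c t + ∑ i, (if σ i then (1 : ℝ) else -1) * a t i) := by
  induction n with
  | zero => intro c a b _ _ _ _; simp
  | succ n ih =>
    intro c a b hc ha hb hab
    have key : ∀ F : (Fin (n + 1) → Bool) → ℝ,
        ∑ σ, F σ = ∑ s : Bool, ∑ τ : Fin n → Bool, F (Fin.cons s τ) := by
      intro F
      rw [← (Fin.consEquiv (fun _ => Bool)).sum_comp, Fintype.sum_prod_type]
      rfl
    rw [key, key]
    simp only [Fin.sum_univ_succ, Fin.cons_zero, Fin.cons_succ, ← add_assoc]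
    refine (Finset.sum_le_sum fun s _ => ih
      (fun t => c t + (if s then (1 : ℝ) else -1) * b t 0)
      (fun t i => a t i.succ) (fun t i => b t i.succ)
      (hc.add ((hb 0).const_mul _)) (fun i => ha _) (fun i => hb _)
      (fun i => hab _)).trans ?_
    rw [Finset.sum_comm, Finset.sum_comm (s := (Finset.univ : Finset Bool))]
    refine Finset.sum_le_sum fun τ _ => ?_
    have := contraction_step
      (fun t => c t + ∑ i : Fin n, (if τ i then (1 : ℝ) else -1) * a t i.succ)
      (fun t => a t 0) (fun t => b t 0)
      (hc.add (AbsBdd.sum _ fun i => (ha _).const_mul _)) (ha 0) (hab 0)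
    simpa [add_right_comm] using this

/-- Talagrand's contraction lemma: composing a function class with an
`L`-Lipschitz map `φ` multiplies the empirical Rademacher complexity by at most `L`. -/
theorem rademacher_contraction {X : Type*} (m : ℕ) (hm : 0 < m) (x : Fin m → X)
    (F : Set (X → ℝ)) (L : ℝ) (hL : 0 ≤ L)
    (φ : ℝ → ℝ) (hφ : ∀ a b : ℝ, |φ a - φ b| ≤ L * |a - b|)
    (hbddF : ∀ σ : Fin m → Bool, BddAbove
      ((fun f => (m : ℝ)⁻¹ * ∑ i, (if σ i then (1 : ℝ) else -1) * f (x i)) '' F))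
    (hbddφF : ∀ σ : Fin m → Bool, BddAbove
      ((fun f => (m : ℝ)⁻¹ * ∑ i, (if σ i then (1 : ℝ) else -1) * f (x i)) ''
        ((fun f => φ ∘ f) '' F))) :
    rademacher m x ((fun f => φ ∘ f) '' F) ≤ L * rademacher m x F := by
  rcases F.eq_empty_or_nonempty with rfl | hne
  · simp [rademacher]
  have : Nonempty F := hne.to_subtype
  have hm' : (0 : ℝ) ≤ (m : ℝ)⁻¹ := by positivity
  have hA : ∀ i, AbsBdd (fun t : F => (m : ℝ)⁻¹ * t.1 (x i)) := by
    refine absBdd_coord (fun (t : F) i => (m : ℝ)⁻¹ * t.1 (x i)) fun σ => ?_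
    obtain ⟨M, hM⟩ := hbddF σ
    refine ⟨M, fun t => ?_⟩
    have := hM ⟨t.1, t.2, rfl⟩
    simpa [Finset.mul_sum, mul_left_comm] using this
  have hB : ∀ i, AbsBdd (fun t : F => (m : ℝ)⁻¹ * φ (t.1 (x i))) := by
    refine absBdd_coord (fun (t : F) i => (m : ℝ)⁻¹ * φ (t.1 (x i))) fun σ => ?_
    obtain ⟨M, hM⟩ := hbddφF σ
    refine ⟨M, fun t => ?_⟩
    have := hM ⟨φ ∘ t.1, ⟨t.1, t.2, rfl⟩, rfl⟩
    simpa [Finset.mul_sum, mul_left_comm] using this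
  have main := contraction_aux m (fun _ : F => (0 : ℝ))
    (fun t i => L * ((m : ℝ)⁻¹ * t.1 (x i))) (fun t i => (m : ℝ)⁻¹ * φ (t.1 (x i)))
    ⟨0, by simp⟩ (fun i => (hA i).const_mul L) hB (by
      intro i t t'
      rw [← mul_sub, ← mul_sub, ← mul_sub, abs_mul, abs_mul, abs_mul, abs_of_nonneg hm',
        abs_of_nonneg hL, mul_left_comm]
      exact mul_le_mul_of_nonneg_left (hφ _ _) hm')
  unfold rademacher
  rw [← mul_div_assoc, Finset.mul_sum]
  refine div_le_div_of_nonneg_right ?_ (by positivity)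
  refine le_of_eq_of_le (Finset.sum_congr rfl fun σ _ => ?_)
    (main.trans_eq (Finset.sum_congr rfl fun σ _ => Eq.symm ?_))
  · rw [Set.image_image, sSup_image']
    refine iSup_congr fun t => ?_
    rw [zero_add, Finset.mul_sum]
    exact Finset.sum_congr rfl fun i _ => by simp only [Function.comp]; ring
  · rw [sSup_image', Real.mul_iSup_of_nonneg hL]
    refine iSup_congr fun t => ?_
    rw [zero_add, Finset.mul_sum, Finset.mul_sum]
    exact Finset.sum_congr rfl fun i _ => by ring
end
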